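/- Let R = ∏_{i∈I} R_i with each R_i = End_{K_i}(U_i) the endomorphism ring of a left vector space U_i over a field K_i with 1 ≤ dim U_i < ∞ (I non-empty), let 𝔐 = ∏_{i∈I} 𝔐_i be the product space associated to ℙ(R), and let Ψ: ℙ(R) → 𝒢 = ∏_{i∈I} 𝒢_i be the bijection p ↦ (Ψ_i(p_i))_{i∈I}. Then for all p, q, r ∈ ℙ(R): (1) p ∼ q if and only if Ψ(p) and Ψ(q) are distinct collinear points of 𝔐; (2) p ∼ q via r if and only if Ψ(p), Ψ(q), Ψ(r) are three distinct collinear points of 𝔐. -/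

import Mathlib

/-- `p` is a point of the projective line over `R`. -/
def IsPoint (R : Type*) [Ring R] (p : Submodule R (R × R)) : Prop :=
  ∃ g : (Matrix (Fin 2) (Fin 2) R)ˣ,
    p = Submodule.span R {(g.val 0 0, g.val 0 1)}

/-- distant relation -/
def Distant {R : Type*} [Ring R] (p q : Submodule R (R × R)) : Prop :=
  ∃ g : (Matrix (Fin 2) (Fin 2) R)ˣ,
    p = Submodule.span R {(g.val 0 0, g.val 0 1)} ∧
    q = Submodule.span R {(g.val 1 0, g.val 1 1)}

/-- `△(p)`: the set of points distant to `p`. -/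
def DistantSet {R : Type*} [Ring R] (p : Submodule R (R × R)) :
    Set (Submodule R (R × R)) := {x | Distant x p}

/-- `p ∥ q` iff `△(p) ⊆ △(q)`. -/
def Parallel {R : Type*} [Ring R] (p q : Submodule R (R × R)) : Prop :=
  DistantSet p ⊆ DistantSet q

/-- `p ∼ q` via `r`: `r ∦ p`, `r ∦ q` and `△(r) ⊆ △(p) ∪ △(q)`. -/
def AdjacentVia {R : Type*} [Ring R] (p q r : Submodule R (R × R)) : Prop :=
  ¬ Parallel r p ∧ ¬ Parallel r q ∧ DistantSet r ⊆ DistantSet p ∪ DistantSet q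

/-- `p ∼ q`: there is a point `r` with `p ∼ q` via `r`. -/
def Adjacent {R : Type*} [Ring R] (p q : Submodule R (R × R)) : Prop :=
  ∃ r, IsPoint R r ∧ AdjacentVia p q r

open MulOpposite

/-- `End_K(U)` with endomorphisms written on the right, as in the paper. -/
abbrev EndOp (K U : Type*) [DivisionRing K] [AddCommGroup U] [Module K U] :=
  (Module.End K U)ᵐᵒᵖ

/-- Two families are distinct collinear points of the Segre product of Grassmann spaces:
they lie on a common line, i.e. they agree in all coordinates away from some `j`, and their
`j`-th coordinates lie in a common pencil. -/
def SegreCollinear₂ {I : Type*} {K U : I → Type*} [∀ i, DivisionRing (K i)]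
    [∀ i, AddCommGroup (U i)] [∀ i, Module (K i) (U i)]
    (X Y : ∀ i, Submodule (K i) (U i × U i)) : Prop :=
  ∃ (j : I) (M N : Submodule (K j) (U j × U j)),
    Module.finrank (K j) M = Module.finrank (K j) (U j) - 1 ∧
    Module.finrank (K j) N = Module.finrank (K j) (U j) + 1 ∧ M < N ∧
    (M < X j ∧ X j < N) ∧ (M < Y j ∧ Y j < N) ∧ (∀ i, i ≠ j → X i = Y i)

/-- Three families are collinear points of the Segre product of Grassmann spaces. -/
def SegreCollinear₃ {I : Type*} {K U : I → Type*} [∀ i, DivisionRing (K i)]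
    [∀ i, AddCommGroup (U i)] [∀ i, Module (K i) (U i)]
    (X Y Z : ∀ i, Submodule (K i) (U i × U i)) : Prop :=
  ∃ (j : I) (M N : Submodule (K j) (U j × U j)),
    Module.finrank (K j) M = Module.finrank (K j) (U j) - 1 ∧
    Module.finrank (K j) N = Module.finrank (K j) (U j) + 1 ∧ M < N ∧
    (M < X j ∧ X j < N) ∧ (M < Y j ∧ Y j < N) ∧ (M < Z j ∧ Z j < N) ∧
    (∀ i, i ≠ j → X i = Y i ∧ Y i = Z i)

section Pencil

open Module

variable {K V : Type*} [DivisionRing K] [AddCommGroup V] [Module K V]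

theorem Submodule.exists_isCompl_not_disjoint {P R : Submodule K V} (h : ¬ P ≤ R) :
    ∃ X, IsCompl X R ∧ ¬ Disjoint X P := by
  obtain ⟨v, hvP, hvR⟩ := SetLike.not_le_iff_exists.1 h
  obtain ⟨X, hX, hc⟩ := ((Submodule.disjoint_span_singleton_of_notMem hvR).symm).exists_isCompl
  refine ⟨X, hc, fun hd => hvR ?_⟩
  have hvX : v ∈ X := hX (Submodule.mem_span_singleton_self v)
  rw [Submodule.disjoint_def.1 hd v hvX hvP]
  exact R.zero_mem

variable [FiniteDimensional K V]

theorem Submodule.not_le_of_ne_of_finrank_eq {P R : Submodule K V}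
    (h : finrank K P = finrank K R) (hne : P ≠ R) : ¬ P ≤ R :=
  fun hle => hne (Submodule.eq_of_le_of_finrank_eq hle h)

theorem Submodule.inf_eq_of_lt_pencil {n : ℕ} {M P Q : Submodule K V}
    (hM : finrank K M = n - 1) (hP : finrank K P = n) (hQ : finrank K Q = n)
    (hMP : M < P) (hMQ : M < Q) (hPQ : P ≠ Q) : P ⊓ Q = M := by
  have hlt : P ⊓ Q < P := lt_of_le_of_ne inf_le_left fun h =>
    Submodule.not_le_of_ne_of_finrank_eq (hP.trans hQ.symm) hPQ (inf_eq_left.1 h)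
  have := Submodule.finrank_lt_finrank_of_lt hlt
  exact (Submodule.eq_of_le_of_finrank_le (le_inf hMP.le hMQ.le) (by omega)).symm

theorem Submodule.disjoint_or_disjoint_of_pencil {n : ℕ} {M N P Q R X : Submodule K V}
    (hV : finrank K V = n + n) (hM : finrank K M = n - 1) (hN : finrank K N = n + 1)
    (hP : finrank K P = n) (hQ : finrank K Q = n) (hR : finrank K R = n)
    (hMP : M < P) (hMQ : M < Q) (hMR : M < R) (hPN : P < N) (hQN : Q < N) (hRN : R < N)
    (hPQ : P ≠ Q) (hX : IsCompl X R) : Disjoint X P ∨ Disjoint X Q := by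
  by_contra! h
  obtain ⟨hXP, hXQ⟩ := h
  simp only [Submodule.disjoint_def, not_forall] at hXP hXQ
  obtain ⟨v, hvX, hvP, hv⟩ := hXP
  obtain ⟨w, hwX, hwQ, hw⟩ := hXQ
  have hsup : N ⊔ X = ⊤ := by
    rw [eq_top_iff, ← hX.sup_eq_top, sup_comm X]
    exact sup_le_sup_right hRN.le X
  have hdim := Submodule.finrank_sup_add_finrank_inf_eq N X
  have hXR := Submodule.finrank_add_eq_of_isCompl hX
  rw [hsup, finrank_top] at hdim
  have hone : finrank K (N ⊓ X : Submodule K V) = 1 := by omega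
  have hspan := (finrank_eq_one_iff_of_nonzero' (⟨v, hPN.le hvP, hvX⟩ : (N ⊓ X : Submodule K V))
    (fun h0 => hv (congrArg Subtype.val h0))).1 hone ⟨w, hQN.le hwQ, hwX⟩
  obtain ⟨c, hc⟩ := hspan
  have hwP : w ∈ P := by
    have hcw : c • v = w := congrArg Subtype.val hc
    exact hcw ▸ P.smul_mem c hvP
  have hwM : w ∈ M := by
    rw [← Submodule.inf_eq_of_lt_pencil hM hP hQ hMP hMQ hPQ]
    exact ⟨hwP, hwQ⟩
  exact hw (Submodule.disjoint_def.1 hX.disjoint w hwX (hMR.le hwM))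

theorem Submodule.exists_pencil_of_disjoint_or_disjoint {n : ℕ} {P Q R : Submodule K V}
    (hn : 1 ≤ n) (hP : finrank K P = n) (hQ : finrank K Q = n) (hR : finrank K R = n)
    (hPR : P ≠ R) (hQR : Q ≠ R)
    (h : ∀ X, IsCompl X R → Disjoint X P ∨ Disjoint X Q) :
    P ≠ Q ∧ ∃ M N : Submodule K V, finrank K M = n - 1 ∧ finrank K N = n + 1 ∧ M < N ∧
      (M < P ∧ P < N) ∧ (M < Q ∧ Q < N) ∧ (M < R ∧ R < N) := by
  have key : ∀ S, Disjoint S R → Disjoint S P ∨ Disjoint S Q := fun S hS => by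
    obtain ⟨X, hSX, hX⟩ := hS.exists_isCompl
    exact (h X hX).imp (fun hd => hd.mono_left hSX) (fun hd => hd.mono_left hSX)
  have hnPR := Submodule.not_le_of_ne_of_finrank_eq (hP.trans hR.symm) hPR
  have hnQR := Submodule.not_le_of_ne_of_finrank_eq (hQ.trans hR.symm) hQR
  have hne : P ≠ Q := by
    rintro rfl
    obtain ⟨X, hX, hXP⟩ := Submodule.exists_isCompl_not_disjoint hnPR
    exact (h X hX).elim hXP hXP
  have hinf : P ⊓ Q ≤ R := fun v hv => by
    by_contra hvR
    have hv0 : v ≠ 0 := fun h0 => hvR (h0 ▸ R.zero_mem)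
    have hmem := Submodule.mem_span_singleton_self (R := K) v
    rcases key _ (Submodule.disjoint_span_singleton_of_notMem hvR).symm with hd | hd
    · exact hv0 (Submodule.disjoint_def.1 hd v hmem hv.1)
    · exact hv0 (Submodule.disjoint_def.1 hd v hmem hv.2)
  have hdep : ∀ v ∈ P, v ∉ R → ∀ w ∈ Q, w ∉ R → v ∈ R ⊔ K ∙ w := fun v hvP hvR w hwQ hwR => by
    by_contra hcon
    have hv0 : v ≠ 0 := fun h0 => hvR (h0 ▸ R.zero_mem)
    have hw0 : w ≠ 0 := fun h0 => hwR (h0 ▸ R.zero_mem)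
    have hd : Disjoint (K ∙ v ⊔ K ∙ w) R := by
      refine (Submodule.disjoint_span_singleton_of_notMem hwR).symm
        |>.disjoint_sup_left_of_disjoint_sup_right ?_
      rw [sup_comm]
      exact (Submodule.disjoint_span_singleton_of_notMem hcon).symm
    rcases key _ hd with hd | hd
    · exact hv0 (Submodule.disjoint_def.1 hd v
        (Submodule.mem_sup_left (Submodule.mem_span_singleton_self v)) hvP)
    · exact hw0 (Submodule.disjoint_def.1 hd w
        (Submodule.mem_sup_right (Submodule.mem_span_singleton_self w)) hwQ)
  obtain ⟨v, hvP, hvR⟩ := SetLike.not_le_iff_exists.1 hnPR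
  obtain ⟨w, hwQ, hwR⟩ := SetLike.not_le_iff_exists.1 hnQR
  have hPN : P ≤ R ⊔ K ∙ w := fun x hx => by
    by_cases hxR : x ∈ R
    · exact Submodule.mem_sup_left hxR
    · exact hdep x hx hxR w hwQ hwR
  have hdim : ∀ u ∉ R, finrank K (R ⊔ K ∙ u : Submodule K V) = n + 1 := fun u huR => by
    have hu0 : u ≠ 0 := fun h0 => huR (h0 ▸ R.zero_mem)
    have h1 := Submodule.finrank_sup_add_finrank_inf_eq R (K ∙ u)
    rwa [(Submodule.disjoint_span_singleton_of_notMem huR).eq_bot, finrank_bot,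
      finrank_span_singleton hu0, hR] at h1
  have heq : ∀ x ∈ Q, x ∉ R → R ⊔ K ∙ v = R ⊔ K ∙ x := fun x hx hxR =>
    Submodule.eq_of_le_of_finrank_eq
      (sup_le le_sup_left ((Submodule.span_singleton_le_iff_mem _ _).2 (hdep v hvP hvR x hx hxR)))
      ((hdim v hvR).trans (hdim x hxR).symm)
  have hN := hdim w hwR
  have hQN : Q ≤ R ⊔ K ∙ w := fun x hx => by
    by_cases hxR : x ∈ R
    · exact Submodule.mem_sup_left hxR
    · rw [← heq w hwQ hwR, heq x hx hxR]
      exact Submodule.mem_sup_right (Submodule.mem_span_singleton_self x)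
  have hM : finrank K (P ⊓ Q : Submodule K V) = n - 1 := by
    have h1 := Submodule.finrank_sup_add_finrank_inf_eq P Q
    have h2 := Submodule.finrank_mono (sup_le hPN hQN)
    have hlt : P ⊓ Q < P := lt_of_le_of_ne inf_le_left fun h =>
      Submodule.not_le_of_ne_of_finrank_eq (hP.trans hQ.symm) hne (inf_eq_left.1 h)
    have := Submodule.finrank_lt_finrank_of_lt hlt
    omega
  have lt_of : ∀ {A B : Submodule K V}, A ≤ B → finrank K A < finrank K B → A < B :=
    fun hle hlt => lt_of_le_of_ne hle fun he => by rw [he] at hlt; exact hlt.false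
  exact ⟨hne, P ⊓ Q, R ⊔ K ∙ w, hM, hN, lt_of (inf_le_left.trans hPN) (by omega),
    ⟨lt_of inf_le_left (by omega), lt_of hPN (by omega)⟩,
    ⟨lt_of inf_le_right (by omega), lt_of hQN (by omega)⟩,
    ⟨lt_of hinf (by omega), lt_of le_sup_left (by omega)⟩⟩

theorem Submodule.exists_third_of_pencil {n : ℕ} {M N P Q : Submodule K V}
    (hn : 1 ≤ n) (hM : finrank K M = n - 1) (hN : finrank K N = n + 1)
    (hP : finrank K P = n) (hQ : finrank K Q = n)
    (hMP : M < P) (hMQ : M < Q) (hPN : P < N) (hQN : Q < N) (hPQ : P ≠ Q) :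
    ∃ R : Submodule K V, finrank K R = n ∧ M < R ∧ R < N ∧ R ≠ P ∧ R ≠ Q := by
  have hinf := Submodule.inf_eq_of_lt_pencil hM hP hQ hMP hMQ hPQ
  obtain ⟨v, hvP, hvM⟩ := SetLike.exists_of_lt hMP
  obtain ⟨w, hwQ, hwM⟩ := SetLike.exists_of_lt hMQ
  have hP' : v + w ∉ P := fun h => hwM (hinf ▸ ⟨(P.add_mem_iff_right hvP).1 h, hwQ⟩)
  have hQ' : v + w ∉ Q := fun h => hvM (hinf ▸ ⟨hvP, (Q.add_mem_iff_left hwQ).1 h⟩)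
  have hmem : v + w ∈ M ⊔ K ∙ (v + w) :=
    Submodule.mem_sup_right (Submodule.mem_span_singleton_self _)
  have h0 : v + w ≠ 0 := fun h => hP' (h ▸ P.zero_mem)
  have hR : finrank K (M ⊔ K ∙ (v + w) : Submodule K V) = n := by
    have h1 := Submodule.finrank_sup_add_finrank_inf_eq M (K ∙ (v + w))
    rw [(Submodule.disjoint_span_singleton_of_notMem fun h => hP' (hMP.le h)).eq_bot, finrank_bot,
      finrank_span_singleton h0] at h1
    omega
  refine ⟨M ⊔ K ∙ (v + w), hR, lt_of_le_of_ne le_sup_left fun he => hP' (hMP.le (he ▸ hmem)),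
    lt_of_le_of_ne (sup_le (hMP.le.trans hPN.le) ((Submodule.span_singleton_le_iff_mem _ _).2
      (N.add_mem (hPN.le hvP) (hQN.le hwQ)))) fun he => ?_,
    fun he => hP' (he ▸ hmem), fun he => hQ' (he ▸ hmem)⟩
  rw [he] at hR
  omega

end Pencil

section Distant

theorem Distant.isPoint_left {R : Type*} [Ring R] {p q : Submodule R (R × R)} (h : Distant p q) :
    IsPoint R p := by
  obtain ⟨g, hp, -⟩ := h
  exact ⟨g, hp⟩

variable {K U : Type*} [DivisionRing K] [AddCommGroup U] [Module K U]

theorem EndOp.codisjoint_range_prod {a b c d x y z w : EndOp K U}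
    (h₁ : x * a + y * c = 1) (h₂ : x * b + y * d = 0)
    (h₃ : z * a + w * c = 0) (h₄ : z * b + w * d = 1) :
    Codisjoint (LinearMap.range ((unop a).prod (unop b)))
      (LinearMap.range ((unop c).prod (unop d))) := by
  rw [codisjoint_iff, eq_top_iff]
  rintro ⟨u, v⟩ -
  have e₁ := LinearMap.congr_fun (congrArg unop h₁) u
  have e₂ := LinearMap.congr_fun (congrArg unop h₂) u
  have e₃ := LinearMap.congr_fun (congrArg unop h₃) v
  have e₄ := LinearMap.congr_fun (congrArg unop h₄) v
  simp only [unop_add, unop_mul, unop_one, unop_zero, LinearMap.add_apply, Module.End.mul_apply,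
    Module.End.one_apply, LinearMap.zero_apply] at e₁ e₂ e₃ e₄
  refine Submodule.mem_sup.2 ⟨_, ⟨unop x u + unop z v, rfl⟩, _, ⟨unop y u + unop w v, rfl⟩, ?_⟩
  ext
  · simp only [LinearMap.prod_apply, Function.prod_apply, Prod.fst_add, map_add]
    rw [add_add_add_comm, e₁, e₃, add_zero]
  · simp only [LinearMap.prod_apply, Function.prod_apply, Prod.snd_add, map_add]
    rw [add_add_add_comm, e₂, e₄, zero_add]

theorem EndOp.exists_matrix_inverse [FiniteDimensional K U] {a b c d : EndOp K U}
    (h : Codisjoint (LinearMap.range ((unop a).prod (unop b)))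
      (LinearMap.range ((unop c).prod (unop d)))) :
    ∃ H : Matrix (Fin 2) (Fin 2) (EndOp K U),
      !![a, b; c, d] * H = 1 ∧ H * !![a, b; c, d] = 1 := by
  let f := ((unop a).prod (unop b)).coprod ((unop c).prod (unop d))
  have hs : Function.Surjective f := by
    rw [← LinearMap.range_eq_top, LinearMap.range_coprod]
    exact h.eq_top
  let e := LinearEquiv.ofBijective f ⟨LinearMap.injective_iff_surjective.2 hs, hs⟩
  have he : ∀ u v, e (u, v) = (unop a u + unop c v, unop b u + unop d v) := fun u v => rfl
  let k := e.symm.toLinearMap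
  let H : Matrix (Fin 2) (Fin 2) (EndOp K U) :=
    !![op (LinearMap.fst K U U ∘ₗ k ∘ₗ LinearMap.inl K U U),
       op (LinearMap.snd K U U ∘ₗ k ∘ₗ LinearMap.inl K U U);
       op (LinearMap.fst K U U ∘ₗ k ∘ₗ LinearMap.inr K U U),
       op (LinearMap.snd K U U ∘ₗ k ∘ₗ LinearMap.inr K U U)]
  have hk : ∀ u v, k (u, v) = k (u, 0) + k (0, v) := fun u v => by
    rw [← map_add]; simp
  have hke : ∀ u v, k (unop a u + unop c v, 0) + k (0, unop b u + unop d v) = (u, v) :=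
    fun u v => by
      rw [← hk, ← he]
      exact e.symm_apply_apply (u, v)
  have hek : ∀ x : U × U, (unop a (k x).1 + unop c (k x).2, unop b (k x).1 + unop d (k x).2) = x :=
    fun x => (he _ _).symm.trans (e.apply_symm_apply x)
  refine ⟨H, Matrix.ext fun i j => unop_injective (LinearMap.ext fun u => ?_),
    Matrix.ext fun i j => unop_injective (LinearMap.ext fun u => ?_)⟩
  · have e₁ := hke u 0
    have e₂ := hke 0 u
    simp only [map_zero, add_zero, zero_add] at e₁ e₂
    have e₁₁ := congrArg Prod.fst e₁
    have e₁₂ := congrArg Prod.snd e₁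
    have e₂₁ := congrArg Prod.fst e₂
    have e₂₂ := congrArg Prod.snd e₂
    fin_cases i <;> fin_cases j <;> simpa [H, Matrix.mul_apply]
  · have e₁₁ := congrArg Prod.fst (hek (u, 0))
    have e₁₂ := congrArg Prod.snd (hek (u, 0))
    have e₂₁ := congrArg Prod.fst (hek (0, u))
    have e₂₂ := congrArg Prod.snd (hek (0, u))
    fin_cases i <;> fin_cases j <;> simpa [H, Matrix.mul_apply]

theorem EndOp.exists_unit {I : Type*} {K U : I → Type*} [∀ i, DivisionRing (K i)]
    [∀ i, AddCommGroup (U i)] [∀ i, Module (K i) (U i)] [∀ i, FiniteDimensional (K i) (U i)]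
    {a b c d : ∀ i, EndOp (K i) (U i)}
    (h : ∀ i, Codisjoint (LinearMap.range ((unop (a i)).prod (unop (b i))))
      (LinearMap.range ((unop (c i)).prod (unop (d i))))) :
    ∃ g : (Matrix (Fin 2) (Fin 2) (∀ i, EndOp (K i) (U i)))ˣ, g.val = !![a, b; c, d] := by
  choose H hl hr using fun i => EndOp.exists_matrix_inverse (h i)
  refine ⟨⟨!![a, b; c, d], Matrix.of fun k l i => H i k l, ?_, ?_⟩, rfl⟩
  · ext k l i : 3
    have := congrFun (congrFun (hl i) k) l
    fin_cases k <;> fin_cases l <;> simpa [Matrix.mul_apply] using this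
  · ext k l i : 3
    have := congrFun (congrFun (hr i) k) l
    fin_cases k <;> fin_cases l <;> simpa [Matrix.mul_apply] using this

variable {I : Type*} {K U : I → Type*} [∀ i, DivisionRing (K i)]
  [∀ i, AddCommGroup (U i)] [∀ i, Module (K i) (U i)] [∀ i, FiniteDimensional (K i) (U i)]

theorem distant_iff_isCompl
    {Ψ : Submodule (Π i, EndOp (K i) (U i))
        ((Π i, EndOp (K i) (U i)) × (Π i, EndOp (K i) (U i))) →
      ∀ i, Submodule (K i) (U i × U i)}
    (hΨ : ∀ (a b : Π i, EndOp (K i) (U i)),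
      IsPoint (Π i, EndOp (K i) (U i)) (Submodule.span (Π i, EndOp (K i) (U i)) {(a, b)}) →
      ∀ i, Ψ (Submodule.span (Π i, EndOp (K i) (U i)) {(a, b)}) i =
        LinearMap.range ((unop (a i)).prod (unop (b i))))
    (hΨbij : Set.BijOn Ψ {p | IsPoint (Π i, EndOp (K i) (U i)) p}
      {X : ∀ i, Submodule (K i) (U i × U i) |
        ∀ i, Module.finrank (K i) (X i) = Module.finrank (K i) (U i)})
    {p q : Submodule (Π i, EndOp (K i) (U i))
      ((Π i, EndOp (K i) (U i)) × (Π i, EndOp (K i) (U i)))}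
    (hp : IsPoint _ p) (hq : IsPoint _ q) :
    Distant p q ↔ ∀ i, IsCompl (Ψ p i) (Ψ q i) := by
  constructor
  · rintro ⟨g, hpg, hqg⟩ i
    have hcod : Codisjoint (Ψ p i) (Ψ q i) := by
      rw [hpg, hqg, hΨ _ _ (hpg ▸ hp), hΨ _ _ (hqg ▸ hq)]
      have hent : ∀ k l, (g.inv k 0 i) * (g.val 0 l i) + (g.inv k 1 i) * (g.val 1 l i) =
          (1 : Matrix (Fin 2) (Fin 2) (Π i, EndOp (K i) (U i))) k l i := fun k l => by
        rw [← g.inv_val, Matrix.mul_apply, Fin.sum_univ_two]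
        rfl
      exact EndOp.codisjoint_range_prod (hent 0 0) (hent 0 1) (hent 1 0) (hent 1 1)
    refine ⟨?_, hcod⟩
    have hdim := Submodule.finrank_sup_add_finrank_inf_eq (Ψ p i) (Ψ q i)
    rw [hcod.eq_top, finrank_top, Module.finrank_prod, hΨbij.mapsTo hp i, hΨbij.mapsTo hq i]
      at hdim
    exact disjoint_iff.2 (Submodule.finrank_eq_zero.1 (by omega))
  · intro h
    obtain ⟨g₁, rfl⟩ := hp
    obtain ⟨g₂, rfl⟩ := hq
    obtain ⟨g, hg⟩ := EndOp.exists_unit fun i => by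
      have := (h i).codisjoint
      rwa [hΨ _ _ ⟨g₁, rfl⟩, hΨ _ _ ⟨g₂, rfl⟩] at this
    exact ⟨g, by simp [hg], by simp [hg]⟩

theorem distantSet_subset_union_iff
    {Ψ : Submodule (Π i, EndOp (K i) (U i))
        ((Π i, EndOp (K i) (U i)) × (Π i, EndOp (K i) (U i))) →
      ∀ i, Submodule (K i) (U i × U i)}
    (hΨ : ∀ (a b : Π i, EndOp (K i) (U i)),
      IsPoint (Π i, EndOp (K i) (U i)) (Submodule.span (Π i, EndOp (K i) (U i)) {(a, b)}) →
      ∀ i, Ψ (Submodule.span (Π i, EndOp (K i) (U i)) {(a, b)}) i =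
        LinearMap.range ((unop (a i)).prod (unop (b i))))
    (hΨbij : Set.BijOn Ψ {p | IsPoint (Π i, EndOp (K i) (U i)) p}
      {X : ∀ i, Submodule (K i) (U i × U i) |
        ∀ i, Module.finrank (K i) (X i) = Module.finrank (K i) (U i)})
    {p q r : Submodule (Π i, EndOp (K i) (U i))
      ((Π i, EndOp (K i) (U i)) × (Π i, EndOp (K i) (U i)))}
    (hp : IsPoint _ p) (hq : IsPoint _ q) (hr : IsPoint _ r) :
    DistantSet r ⊆ DistantSet p ∪ DistantSet q ↔
      ∀ X : ∀ i, Submodule (K i) (U i × U i), (∀ i, IsCompl (X i) (Ψ r i)) →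
        (∀ i, IsCompl (X i) (Ψ p i)) ∨ ∀ i, IsCompl (X i) (Ψ q i) := by
  constructor
  · intro h X hX
    obtain ⟨x, hx, rfl⟩ := hΨbij.surjOn (show X ∈ _ from fun i => by
      have h1 := Submodule.finrank_add_eq_of_isCompl (hX i)
      rw [Module.finrank_prod, hΨbij.mapsTo hr i] at h1
      omega)
    rw [← distant_iff_isCompl hΨ hΨbij hx hp, ← distant_iff_isCompl hΨ hΨbij hx hq]
    exact h ((distant_iff_isCompl hΨ hΨbij hx hr).2 hX)
  · intro h x hxr
    have hx : IsPoint _ x := Distant.isPoint_left hxr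
    have := h (Ψ x) ((distant_iff_isCompl hΨ hΨbij hx hr).1 hxr)
    rwa [← distant_iff_isCompl hΨ hΨbij hx hp, ← distant_iff_isCompl hΨ hΨbij hx hq] at this

end Distant

section Segre

open Module

variable {I : Type*} {K U : I → Type*} [∀ i, DivisionRing (K i)]
  [∀ i, AddCommGroup (U i)] [∀ i, Module (K i) (U i)]

theorem exists_isCompl_family_update (R : ∀ i, Submodule (K i) (U i × U i)) {j : I}
    {Y : Submodule (K j) (U j × U j)} (hY : IsCompl Y (R j)) :
    ∃ X : ∀ i, Submodule (K i) (U i × U i), (∀ i, IsCompl (X i) (R i)) ∧ X j = Y := by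
  classical
  choose Z hZ using fun i => (R i).exists_isCompl
  refine ⟨Function.update Z j Y, fun i => ?_, Function.update_self ..⟩
  obtain rfl | hij := eq_or_ne i j
  · rwa [Function.update_self]
  · rw [Function.update_of_ne hij]
    exact (hZ i).symm

theorem SegreCollinear₃.left {P Q R : ∀ i, Submodule (K i) (U i × U i)}
    (h : SegreCollinear₃ P Q R) : SegreCollinear₂ P Q := by
  obtain ⟨j, M, N, hM, hN, hMN, hP, hQ, -, heq⟩ := h
  exact ⟨j, M, N, hM, hN, hMN, hP, hQ, fun i hi => (heq i hi).1⟩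

variable [∀ i, FiniteDimensional (K i) (U i)]

theorem eq_of_forall_isCompl_family {P R : ∀ i, Submodule (K i) (U i × U i)}
    (hP : ∀ i, finrank (K i) (P i) = finrank (K i) (U i))
    (hR : ∀ i, finrank (K i) (R i) = finrank (K i) (U i))
    (h : ∀ X : ∀ i, Submodule (K i) (U i × U i), (∀ i, IsCompl (X i) (R i)) →
      ∀ i, IsCompl (X i) (P i)) : R = P := by
  funext i
  by_contra hne
  obtain ⟨Y, hY, hYP⟩ := Submodule.exists_isCompl_not_disjoint
    (Submodule.not_le_of_ne_of_finrank_eq ((hP i).trans (hR i).symm) (Ne.symm hne))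
  obtain ⟨X, hX, rfl⟩ := exists_isCompl_family_update R hY
  exact hYP (h X hX i).disjoint

theorem segreCollinear₃_of_isCompl (hdim : ∀ i, 1 ≤ finrank (K i) (U i))
    {P Q R : ∀ i, Submodule (K i) (U i × U i)}
    (hP : ∀ i, finrank (K i) (P i) = finrank (K i) (U i))
    (hQ : ∀ i, finrank (K i) (Q i) = finrank (K i) (U i))
    (hR : ∀ i, finrank (K i) (R i) = finrank (K i) (U i)) (hPR : P ≠ R) (hQR : Q ≠ R)
    (h : ∀ X : ∀ i, Submodule (K i) (U i × U i), (∀ i, IsCompl (X i) (R i)) →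
      (∀ i, IsCompl (X i) (P i)) ∨ ∀ i, IsCompl (X i) (Q i)) :
    P ≠ Q ∧ SegreCollinear₃ P Q R := by
  classical
  have huniq : ∀ j k, P j ≠ R j → Q k ≠ R k → j = k := fun j k hj hk => by
    by_contra hjk
    obtain ⟨Y, hY, hYP⟩ := Submodule.exists_isCompl_not_disjoint
      (Submodule.not_le_of_ne_of_finrank_eq ((hP j).trans (hR j).symm) hj)
    obtain ⟨Z, hZ, hZQ⟩ := Submodule.exists_isCompl_not_disjoint
      (Submodule.not_le_of_ne_of_finrank_eq ((hQ k).trans (hR k).symm) hk)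
    obtain ⟨W, hW, rfl⟩ := exists_isCompl_family_update R hZ
    have hX : ∀ i, IsCompl (Function.update W j Y i) (R i) := fun i => by
      obtain rfl | hij := eq_or_ne i j
      · rwa [Function.update_self]
      · rw [Function.update_of_ne hij]
        exact hW i
    rcases h _ hX with h' | h'
    · have := h' j
      rw [Function.update_self] at this
      exact hYP this.disjoint
    · have := h' k
      rw [Function.update_of_ne (Ne.symm hjk)] at this
      exact hZQ this.disjoint
  obtain ⟨j, hj⟩ := Function.ne_iff.1 hPR
  obtain ⟨k, hk⟩ := Function.ne_iff.1 hQR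
  obtain rfl := huniq j k hj hk
  have hPi : ∀ i, i ≠ j → P i = R i := fun i hi => by_contra fun hne => hi (huniq i j hne hk)
  have hQi : ∀ i, i ≠ j → Q i = R i := fun i hi => by_contra fun hne => hi (huniq j i hj hne).symm
  obtain ⟨hne, M, N, hM, hN, hMN, hMPN, hMQN, hMRN⟩ :=
    Submodule.exists_pencil_of_disjoint_or_disjoint (hdim j) (hP j) (hQ j) (hR j) hj hk
      fun Y hY => by
        obtain ⟨X, hX, rfl⟩ := exists_isCompl_family_update R hY
        exact (h X hX).imp (fun h' => (h' j).disjoint) (fun h' => (h' j).disjoint)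
  exact ⟨fun he => hne (congrFun he j), j, M, N, hM, hN, hMN, hMPN, hMQN, hMRN,
    fun i hi => ⟨(hPi i hi).trans (hQi i hi).symm, hQi i hi⟩⟩

theorem SegreCollinear₃.isCompl_or_isCompl {P Q R : ∀ i, Submodule (K i) (U i × U i)}
    (hP : ∀ i, finrank (K i) (P i) = finrank (K i) (U i))
    (hQ : ∀ i, finrank (K i) (Q i) = finrank (K i) (U i))
    (hR : ∀ i, finrank (K i) (R i) = finrank (K i) (U i)) (hPQ : P ≠ Q)
    (h : SegreCollinear₃ P Q R) (X : ∀ i, Submodule (K i) (U i × U i))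
    (hX : ∀ i, IsCompl (X i) (R i)) :
    (∀ i, IsCompl (X i) (P i)) ∨ ∀ i, IsCompl (X i) (Q i) := by
  obtain ⟨j, M, N, hM, hN, -, ⟨hMP, hPN⟩, ⟨hMQ, hQN⟩, ⟨hMR, hRN⟩, heq⟩ := h
  have hne : P j ≠ Q j := fun he => hPQ <| funext fun i => by
    obtain rfl | hi := eq_or_ne i j
    · exact he
    · exact (heq i hi).1
  have hXdim := Submodule.finrank_add_eq_of_isCompl (hX j)
  rw [hR j] at hXdim
  refine (Submodule.disjoint_or_disjoint_of_pencil finrank_prod hM hN (hP j) (hQ j) (hR j)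
    hMP hMQ hMR hPN hQN hRN hne (hX j)).imp (fun hd i => ?_) (fun hd i => ?_)
  · obtain rfl | hi := eq_or_ne i j
    · exact (Submodule.isCompl_iff_disjoint _ _ (by rw [hP, hXdim])).2 hd
    · rw [(heq i hi).1, (heq i hi).2]
      exact hX i
  · obtain rfl | hi := eq_or_ne i j
    · exact (Submodule.isCompl_iff_disjoint _ _ (by rw [hQ, hXdim])).2 hd
    · rw [(heq i hi).2]
      exact hX i

theorem SegreCollinear₂.exists_third (hdim : ∀ i, 1 ≤ finrank (K i) (U i))
    {P Q : ∀ i, Submodule (K i) (U i × U i)}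
    (hP : ∀ i, finrank (K i) (P i) = finrank (K i) (U i))
    (hQ : ∀ i, finrank (K i) (Q i) = finrank (K i) (U i)) (hPQ : P ≠ Q)
    (h : SegreCollinear₂ P Q) :
    ∃ R : ∀ i, Submodule (K i) (U i × U i),
      (∀ i, finrank (K i) (R i) = finrank (K i) (U i)) ∧ P ≠ R ∧ Q ≠ R ∧
        SegreCollinear₃ P Q R := by
  classical
  obtain ⟨j, M, N, hM, hN, hMN, hMPN, hMQN, heq⟩ := h
  have hne : P j ≠ Q j := fun he => hPQ <| funext fun i => by
    obtain rfl | hi := eq_or_ne i j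
    · exact he
    · exact heq i hi
  obtain ⟨S, hS, hMS, hSN, hSP, hSQ⟩ := Submodule.exists_third_of_pencil (hdim j) hM hN (hP j)
    (hQ j) hMPN.1 hMQN.1 hMPN.2 hMQN.2 hne
  have hSj : Function.update Q j S j = S := Function.update_self ..
  refine ⟨Function.update Q j S, fun i => ?_, fun he => hSP ?_, fun he => hSQ ?_,
    j, M, N, hM, hN, hMN, hMPN, hMQN, ?_, fun i hi => ⟨heq i hi, ?_⟩⟩
  · obtain rfl | hi := eq_or_ne i j
    · rw [hSj, hS]
    · rw [Function.update_of_ne hi, hQ]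
  · rw [he, hSj]
  · exact hSj.symm.trans (congrFun he j).symm
  · rw [hSj]
    exact ⟨hMS, hSN⟩
  · rw [Function.update_of_ne hi]

end Segre

/-- Let `R = Π_{i ∈ I} R_i` with `R_i = End_{K_i}(U_i)`,
`1 ≤ dim U_i < ∞`, `I` non-empty, let `𝔐 = Π 𝔐_i` be the associated product (Segre) space
and `Ψ : ℙ(R) → 𝒢`, `p ↦ (Ψ_i(p_i))_i`, the canonical bijection.  Then for points
`p, q, r` of `ℙ(R)`: (1) `p ∼ q` iff `Ψ p`, `Ψ q` are distinct collinear points of `𝔐`;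
(2) `p ∼ q` via `r` iff `Ψ p`, `Ψ q`, `Ψ r` are three distinct collinear points of `𝔐`. -/
theorem stmt_14 {I : Type*} [Nonempty I] {K U : I → Type*} [∀ i, DivisionRing (K i)]
    [∀ i, AddCommGroup (U i)] [∀ i, Module (K i) (U i)]
    [∀ i, FiniteDimensional (K i) (U i)]
    (hdim : ∀ i, 1 ≤ Module.finrank (K i) (U i))
    (Ψ : Submodule (Π i, EndOp (K i) (U i))
        ((Π i, EndOp (K i) (U i)) × (Π i, EndOp (K i) (U i))) →
      ∀ i, Submodule (K i) (U i × U i))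
    (hΨ : ∀ (a b : Π i, EndOp (K i) (U i)),
      IsPoint (Π i, EndOp (K i) (U i)) (Submodule.span (Π i, EndOp (K i) (U i)) {(a, b)}) →
      ∀ i, Ψ (Submodule.span (Π i, EndOp (K i) (U i)) {(a, b)}) i =
        LinearMap.range ((unop (a i)).prod (unop (b i))))
    (hΨbij : Set.BijOn Ψ {p | IsPoint (Π i, EndOp (K i) (U i)) p}
      {X : ∀ i, Submodule (K i) (U i × U i) |
        ∀ i, Module.finrank (K i) (X i) = Module.finrank (K i) (U i)})
    (p q r : Submodule (Π i, EndOp (K i) (U i))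
      ((Π i, EndOp (K i) (U i)) × (Π i, EndOp (K i) (U i))))
    (hp : IsPoint _ p) (hq : IsPoint _ q) (hr : IsPoint _ r) :
    (Adjacent p q ↔ (Ψ p ≠ Ψ q ∧ SegreCollinear₂ (Ψ p) (Ψ q))) ∧
    (AdjacentVia p q r ↔ (Ψ p ≠ Ψ q ∧ Ψ p ≠ Ψ r ∧ Ψ q ≠ Ψ r ∧
      SegreCollinear₃ (Ψ p) (Ψ q) (Ψ r))) := by
  have hparallel : ∀ {p r}, IsPoint _ p → IsPoint _ r → (Parallel r p ↔ Ψ r = Ψ p) := by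
    intro p r hp hr
    constructor
    · intro h
      refine eq_of_forall_isCompl_family (hΨbij.mapsTo hp) (hΨbij.mapsTo hr) fun X hX => ?_
      exact or_self_iff.1 ((distantSet_subset_union_iff hΨ hΨbij hp hp hr).1
        (fun x hx => Or.inl (h hx)) X hX)
    · intro h
      rw [hΨbij.injOn hr hp h]
      exact Set.Subset.rfl
  have hvia : ∀ {r}, IsPoint _ r → (AdjacentVia p q r ↔
      (Ψ p ≠ Ψ q ∧ Ψ p ≠ Ψ r ∧ Ψ q ≠ Ψ r ∧ SegreCollinear₃ (Ψ p) (Ψ q) (Ψ r))) := by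
    intro r hr
    rw [AdjacentVia, hparallel hp hr, hparallel hq hr,
      distantSet_subset_union_iff hΨ hΨbij hp hq hr]
    constructor
    · rintro ⟨hpr, hqr, h⟩
      obtain ⟨hpq, hcol⟩ := segreCollinear₃_of_isCompl hdim (hΨbij.mapsTo hp) (hΨbij.mapsTo hq)
        (hΨbij.mapsTo hr) (Ne.symm hpr) (Ne.symm hqr) h
      exact ⟨hpq, Ne.symm hpr, Ne.symm hqr, hcol⟩
    · rintro ⟨hpq, hpr, hqr, h⟩
      exact ⟨hpr.symm, hqr.symm, h.isCompl_or_isCompl (hΨbij.mapsTo hp) (hΨbij.mapsTo hq)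
        (hΨbij.mapsTo hr) hpq⟩
  refine ⟨⟨?_, ?_⟩, hvia hr⟩
  · rintro ⟨s, hs, h⟩
    obtain ⟨hpq, -, -, hcol⟩ := (hvia hs).1 h
    exact ⟨hpq, hcol.left⟩
  · rintro ⟨hpq, hcol⟩
    obtain ⟨S, hS, hpS, hqS, hcol₃⟩ :=
      hcol.exists_third hdim (hΨbij.mapsTo hp) (hΨbij.mapsTo hq) hpq
    obtain ⟨s, hs, rfl⟩ := hΨbij.surjOn hS
    exact ⟨s, hs, (hvia hs).2 ⟨hpq, hpS, hqS, hcol₃⟩⟩
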